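/- arXiv:1908.06652 — 2 statements merged into one kernel-verified Lean document; each statement's English description precedes it below -/
import Mathlib

section
/- Let N = 2^n and 0 ≤ i < N, and let w_i := 2^{p_{n-1}(i)} be the Hamming weight of g_i. Then the counts of minimum-weight words in the level-(n+1) cosets satisfy S^{(n+1)}_{i, w_i} = 2^{w_i} · S^{(n)}_{i, w_i} and S^{(n+1)}_{i+N, 2 w_i} = S^{(n)}_{i, w_i}. -/
/-- Arıkan's 2×2 polarization kernel over GF(2). -/
def G2 : Matrix (Fin 2) (Fin 2) (ZMod 2) := !![1, 0; 1, 1]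

/-- `G n` is the `n`-th Kronecker power `G₂^{⊗n}`, an `2^n × 2^n` matrix over GF(2).
The index `a * 2^n + b` corresponds to the pair `(a, b)`, so the most significant bit
comes from the leftmost Kronecker factor. -/
def G : (n : ℕ) → Matrix (Fin (2 ^ n)) (Fin (2 ^ n)) (ZMod 2)
  | 0 => 1
  | n + 1 =>
    Matrix.reindex (finProdFinEquiv.trans (finCongr (by ring)))
      (finProdFinEquiv.trans (finCongr (by ring)))
      (Matrix.kroneckerMap (· * ·) G2 (G n))

/-- The `i`-th row `g_i` of `G n`. -/
def row (n : ℕ) (i : Fin (2 ^ n)) : Fin (2 ^ n) → ZMod 2 := G n i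

/-- `bit i j` is the `j`-th bit in the binary representation of `i`. -/
def bit (i j : ℕ) : ℕ := i / 2 ^ j % 2

/-- The span of the rows `g_j` of `G n` with `j > i`. -/
def spanAbove (n : ℕ) (i : ℕ) : Submodule (ZMod 2) (Fin (2 ^ n) → ZMod 2) :=
  Submodule.span (ZMod 2) {v | ∃ j : Fin (2 ^ n), i < (j : ℕ) ∧ v = row n j}

/-- The one-coset `C^{(n)}(0^i, 1) = g_i + ⟨g_{i+1}, …, g_{N-1}⟩`. -/
def oneCoset (n : ℕ) (i : Fin (2 ^ n)) : Set (Fin (2 ^ n) → ZMod 2) :=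
  {x | ∃ v ∈ spanAbove n (i : ℕ), x = row n i + v}

/-- `S n i w` is the number of vectors of Hamming weight `w` in `C^{(n)}(0^i, 1)`. -/
noncomputable def S (n : ℕ) (i : Fin (2 ^ n)) (w : ℕ) : ℕ :=
  {x ∈ oneCoset n i | hammingNorm x = w}.ncard

/-- Concatenation of two vectors of length `2^n` into a vector of length `2^(n+1)`. -/
def app2 {n : ℕ} (a b : Fin (2 ^ n) → ZMod 2) : Fin (2 ^ (n + 1)) → ZMod 2 :=
  fun k => Fin.append a b (finCongr (by ring : 2 ^ (n + 1) = 2 ^ n + 2 ^ n) k)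

theorem app2_apply {n : ℕ} (a b : Fin (2 ^ n) → ZMod 2) (k : Fin (2 ^ (n + 1))) :
    app2 a b k = if h : (k : ℕ) < 2 ^ n then a ⟨k, h⟩
      else b ⟨k - 2 ^ n, by have := k.2; have := pow_succ 2 n; omega⟩ := by
  unfold app2
  split_ifs with h
  · have : finCongr (by ring : 2 ^ (n + 1) = 2 ^ n + 2 ^ n) k
        = Fin.castAdd (2 ^ n) ⟨k, h⟩ := by ext; simp
    rw [this, Fin.append_left]
  · have hk := k.2
    have := pow_succ 2 n
    have : finCongr (by ring : 2 ^ (n + 1) = 2 ^ n + 2 ^ n) k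
        = Fin.natAdd (2 ^ n) ⟨k - 2 ^ n, by omega⟩ := by ext; simp; omega
    rw [this, Fin.append_right]

theorem app2_add {n : ℕ} (a b c d : Fin (2 ^ n) → ZMod 2) :
    app2 (a + b) (c + d) = app2 a c + app2 b d := by
  ext k
  simp only [app2_apply, Pi.add_apply]
  split_ifs <;> rfl

theorem app2_smul {n : ℕ} (r : ZMod 2) (a b : Fin (2 ^ n) → ZMod 2) :
    app2 (r • a) (r • b) = r • app2 a b := by
  ext k
  simp only [app2_apply, Pi.smul_apply]
  split_ifs <;> rfl

theorem app2_inj {n : ℕ} {a b c d : Fin (2 ^ n) → ZMod 2} :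
    app2 a b = app2 c d ↔ a = c ∧ b = d := by
  refine ⟨fun h => ⟨?_, ?_⟩, by rintro ⟨rfl, rfl⟩; rfl⟩
  · ext k
    have := congrFun h ⟨k, by have := k.2; have := pow_succ 2 n; omega⟩
    simpa [app2_apply] using this
  · ext k
    have := congrFun h ⟨k + 2 ^ n, by have := k.2; have := pow_succ 2 n; omega⟩
    simpa [app2_apply] using this

theorem exists_eq_app2 {n : ℕ} (z : Fin (2 ^ (n + 1)) → ZMod 2) :
    ∃ a b : Fin (2 ^ n) → ZMod 2, z = app2 a b := by
  refine ⟨fun k => z ⟨k, by have := k.2; have := pow_succ 2 n; omega⟩,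
    fun k => z ⟨k + 2 ^ n, by have := k.2; have := pow_succ 2 n; omega⟩, ?_⟩
  ext k
  rw [app2_apply]
  split_ifs with h
  · rfl
  · congr 1
    ext
    simp
    omega

theorem hammingNorm_eq_sum {m : ℕ} (x : Fin m → ZMod 2) :
    hammingNorm x = ∑ k, if x k ≠ 0 then 1 else 0 := by
  simp [hammingNorm, Finset.card_filter]

theorem hammingNorm_app2 {n : ℕ} (a b : Fin (2 ^ n) → ZMod 2) :
    hammingNorm (app2 a b) = hammingNorm a + hammingNorm b := by
  simp only [hammingNorm_eq_sum]
  refine (Fintype.sum_equiv (finCongr (by ring : 2 ^ (n + 1) = 2 ^ n + 2 ^ n)) _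
    (fun k => if Fin.append a b k ≠ 0 then 1 else 0) (fun _ => rfl)).trans ?_
  rw [Fin.sum_univ_add]
  simp only [Fin.append_left, Fin.append_right]

theorem row_succ_low (n i : ℕ) (hi : i < 2 ^ n) (hi' : i < 2 ^ (n + 1)) :
    row (n + 1) ⟨i, hi'⟩ = app2 (row n ⟨i, hi⟩) 0 := by
  ext k
  have hk := k.2
  have := pow_succ 2 n
  rw [app2_apply]
  simp only [row, G, Matrix.reindex_apply, Matrix.submatrix_apply, Matrix.kroneckerMap_apply]
  split_ifs with h
  · simp [finProdFinEquiv, Fin.divNat, Fin.modNat, Nat.mod_eq_of_lt hi, Nat.mod_eq_of_lt h,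
      Nat.div_eq_of_lt hi, Nat.div_eq_of_lt h, G2]
  · have h1 : (k : ℕ) / 2 ^ n = 1 := by
      rw [Nat.div_eq_iff (by positivity)]; omega
    simp [finProdFinEquiv, Fin.divNat, Nat.div_eq_of_lt hi, h1, G2]

theorem row_succ_high (n i : ℕ) (hi : i < 2 ^ n) (hi' : i + 2 ^ n < 2 ^ (n + 1)) :
    row (n + 1) ⟨i + 2 ^ n, hi'⟩ = app2 (row n ⟨i, hi⟩) (row n ⟨i, hi⟩) := by
  ext k
  have hk := k.2
  have := pow_succ 2 n
  rw [app2_apply]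
  simp only [row, G, Matrix.reindex_apply, Matrix.submatrix_apply, Matrix.kroneckerMap_apply]
  have h2 : (i + 2 ^ n) / 2 ^ n = 1 := by
    rw [Nat.div_eq_iff (by positivity)]; omega
  split_ifs with h
  · simp [finProdFinEquiv, Fin.divNat, Fin.modNat, Nat.mod_eq_of_lt hi, Nat.mod_eq_of_lt h,
      Nat.div_eq_of_lt hi, Nat.div_eq_of_lt h, G2]
  · have h1 : (k : ℕ) / 2 ^ n = 1 := by
      rw [Nat.div_eq_iff (by positivity)]; omega
    have h3 : (k : ℕ) % 2 ^ n = k - 2 ^ n := by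
      rw [Nat.mod_eq_sub_mod (by omega), Nat.mod_eq_of_lt (by omega)]
    simp [finProdFinEquiv, Fin.divNat, Fin.modNat, Nat.mod_eq_of_lt hi,
      Nat.div_eq_of_lt hi, h1, h3, G2]

/-- The linear map `a ↦ (a, 0)`. -/
def app2Left (n : ℕ) : (Fin (2 ^ n) → ZMod 2) →ₗ[ZMod 2] (Fin (2 ^ (n + 1)) → ZMod 2) where
  toFun a := app2 a 0
  map_add' a b := by rw [← app2_add, add_zero]
  map_smul' r a := by rw [RingHom.id_apply, ← app2_smul, smul_zero]

/-- The linear map `a ↦ (a, a)`. -/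
def app2Diag (n : ℕ) : (Fin (2 ^ n) → ZMod 2) →ₗ[ZMod 2] (Fin (2 ^ (n + 1)) → ZMod 2) where
  toFun a := app2 a a
  map_add' a b := app2_add a b a b
  map_smul' r a := app2_smul r a a

theorem app2_add_self {n : ℕ} (a b : Fin (2 ^ n) → ZMod 2) :
    app2 (a + b) b = app2Left n a + app2Diag n b := by
  change _ = app2 a 0 + app2 b b
  rw [← app2_add, zero_add]

theorem rows_above_low (n i : ℕ) :
    {v | ∃ j : Fin (2 ^ (n + 1)), i < (j : ℕ) ∧ v = row (n + 1) j} =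
      app2Left n '' {v | ∃ j : Fin (2 ^ n), i < (j : ℕ) ∧ v = row n j} ∪
      app2Diag n '' {v | ∃ j : Fin (2 ^ n), i < (j : ℕ) + 2 ^ n ∧ v = row n j} := by
  ext v
  constructor
  · rintro ⟨⟨j, hj⟩, hij, rfl⟩
    by_cases h : j < 2 ^ n
    · exact Or.inl ⟨_, ⟨⟨j, h⟩, hij, rfl⟩, (row_succ_low n j h hj).symm⟩
    · obtain ⟨l, rfl⟩ := Nat.exists_eq_add_of_le' (not_lt.1 h)
      have hl : l < 2 ^ n := by rw [pow_succ] at hj; omega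
      exact Or.inr ⟨_, ⟨⟨l, hl⟩, hij, rfl⟩, (row_succ_high n l hl hj).symm⟩
  · rintro (⟨_, ⟨⟨j, hj⟩, hij, rfl⟩, rfl⟩ | ⟨_, ⟨⟨j, hj⟩, hij, rfl⟩, rfl⟩)
    · exact ⟨⟨j, by rw [pow_succ]; omega⟩, hij, (row_succ_low n j hj _).symm⟩
    · exact ⟨⟨j + 2 ^ n, by rw [pow_succ]; omega⟩, hij, (row_succ_high n j hj _).symm⟩

theorem span_rows (n : ℕ) : Submodule.span (ZMod 2) {v | ∃ j, v = row n j} = ⊤ := by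
  induction n with
  | zero =>
    rw [eq_top_iff]
    intro x _
    have : x = x 0 • row 0 0 := by
      ext k
      have hk : k = 0 := Subsingleton.elim (α := Fin 1) k 0
      subst hk
      simp [row, G]
    rw [this]
    exact Submodule.smul_mem _ _ (Submodule.subset_span ⟨0, rfl⟩)
  | succ n ih =>
    rw [eq_top_iff]
    intro z _
    obtain ⟨a, b, rfl⟩ := exists_eq_app2 z
    obtain ⟨c, rfl⟩ : ∃ c, a = c + b := ⟨a - b, by simp⟩
    rw [app2_add_self]
    refine Submodule.add_mem _ ?_ ?_
    · have : app2Left n c ∈ (Submodule.span (ZMod 2) {v | ∃ j, v = row n j}).map (app2Left n) :=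
        Submodule.mem_map_of_mem (by rw [ih]; trivial)
      rw [Submodule.map_span] at this
      refine Submodule.span_mono ?_ this
      rintro _ ⟨_, ⟨j, rfl⟩, rfl⟩
      exact ⟨_, (row_succ_low n j j.2 (by have := j.2; have := pow_succ 2 n; omega)).symm⟩
    · have : app2Diag n b ∈ (Submodule.span (ZMod 2) {v | ∃ j, v = row n j}).map (app2Diag n) :=
        Submodule.mem_map_of_mem (by rw [ih]; trivial)
      rw [Submodule.map_span] at this
      refine Submodule.span_mono ?_ this
      rintro _ ⟨_, ⟨j, rfl⟩, rfl⟩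
      exact ⟨_, (row_succ_high n j j.2 (by have := j.2; have := pow_succ 2 n; omega)).symm⟩

theorem spanAbove_succ_low (n i : ℕ) (hi : i < 2 ^ n) :
    spanAbove (n + 1) i = (spanAbove n i).map (app2Left n) ⊔ (⊤ : Submodule _ _).map (app2Diag n) := by
  have h : {v | ∃ j : Fin (2 ^ n), i < (j : ℕ) + 2 ^ n ∧ v = row n j} = {v | ∃ j, v = row n j} := by
    ext v
    exact exists_congr fun j => and_iff_right (by omega)
  rw [spanAbove, rows_above_low, Submodule.span_union, ← Submodule.map_span,
    ← Submodule.map_span, h, span_rows]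
  rfl

theorem spanAbove_succ_high (n i : ℕ) :
    spanAbove (n + 1) (i + 2 ^ n) = (spanAbove n i).map (app2Diag n) := by
  have h : {v | ∃ j : Fin (2 ^ n), i + 2 ^ n < (j : ℕ) ∧ v = row n j} = ∅ := by
    ext v
    simp only [Set.mem_ofPred_eq, Set.mem_empty_iff_false, iff_false]
    rintro ⟨j, hj, -⟩
    have := j.2
    omega
  rw [spanAbove, rows_above_low, h, Set.image_empty, Set.empty_union, ← Submodule.map_span]
  simp only [Nat.add_lt_add_iff_right]
  rfl

theorem mem_oneCoset_succ_low {n i : ℕ} (hi : i < 2 ^ n) (hi' : i < 2 ^ (n + 1))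
    {z : Fin (2 ^ (n + 1)) → ZMod 2} :
    z ∈ oneCoset (n + 1) ⟨i, hi'⟩ ↔ ∃ x ∈ oneCoset n ⟨i, hi⟩, ∃ y, z = app2 (x + y) y := by
  have hr : row (n + 1) ⟨i, hi'⟩ = app2Left n (row n ⟨i, hi⟩) := row_succ_low n i hi hi'
  simp only [oneCoset, Set.mem_ofPred_eq, spanAbove_succ_low n i hi, hr, app2_add_self]
  constructor
  · rintro ⟨v, hv, rfl⟩
    obtain ⟨_, ⟨a, ha, rfl⟩, _, ⟨b, -, rfl⟩, rfl⟩ := Submodule.mem_sup.1 hv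
    exact ⟨_, ⟨a, ha, rfl⟩, b, by rw [map_add, add_assoc]⟩
  · rintro ⟨_, ⟨a, ha, rfl⟩, b, rfl⟩
    exact ⟨_, Submodule.add_mem_sup (Submodule.mem_map_of_mem ha)
      (Submodule.mem_map_of_mem (Submodule.mem_top (x := b))), by rw [map_add, add_assoc]⟩

theorem oneCoset_succ_high {n i : ℕ} (hi : i < 2 ^ n) (hi' : i + 2 ^ n < 2 ^ (n + 1)) :
    oneCoset (n + 1) ⟨i + 2 ^ n, hi'⟩ = app2Diag n '' oneCoset n ⟨i, hi⟩ := by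
  have hr : row (n + 1) ⟨i + 2 ^ n, hi'⟩ = app2Diag n (row n ⟨i, hi⟩) := row_succ_high n i hi hi'
  ext z
  simp only [oneCoset, Set.mem_ofPred_eq, spanAbove_succ_high n i, hr, Set.mem_image]
  constructor
  · rintro ⟨_, ⟨a, ha, rfl⟩, rfl⟩
    exact ⟨_, ⟨a, ha, rfl⟩, map_add _ _ _⟩
  · rintro ⟨_, ⟨a, ha, rfl⟩, rfl⟩
    exact ⟨_, Submodule.mem_map_of_mem ha, map_add _ _ _⟩

theorem hammingNorm_app2Diag {n : ℕ} (x : Fin (2 ^ n) → ZMod 2) :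
    hammingNorm (app2Diag n x) = 2 * hammingNorm x := by
  rw [two_mul]
  exact hammingNorm_app2 x x

theorem hammingNorm_app2_add_self {n : ℕ} (x y : Fin (2 ^ n) → ZMod 2) :
    hammingNorm (app2 (x + y) y) =
      hammingNorm x + 2 * (Finset.univ.filter fun k => x k = 0 ∧ y k ≠ 0).card := by
  rw [hammingNorm_app2, Finset.card_filter]
  simp only [hammingNorm_eq_sum, Finset.mul_sum, ← Finset.sum_add_distrib, Pi.add_apply]
  refine Finset.sum_congr rfl fun k _ => ?_
  have key : ∀ a b : ZMod 2, ((if a + b ≠ 0 then 1 else 0) + if b ≠ 0 then 1 else 0) =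
      (if a ≠ 0 then 1 else 0) + 2 * if a = 0 ∧ b ≠ 0 then 1 else 0 := by decide
  convert key (x k) (y k)

theorem sum_bit_low {n i : ℕ} (hi : i < 2 ^ n) :
    ∑ s ∈ Finset.range (n + 1), bit i s = ∑ s ∈ Finset.range n, bit i s := by
  rw [Finset.sum_range_succ]
  simp [bit, Nat.div_eq_of_lt hi]

theorem sum_bit_high {n i : ℕ} (hi : i < 2 ^ n) :
    ∑ s ∈ Finset.range (n + 1), bit (i + 2 ^ n) s = ∑ s ∈ Finset.range n, bit i s + 1 := by
  rw [Finset.sum_range_succ]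
  congr 1
  · refine Finset.sum_congr rfl fun s hs => ?_
    obtain ⟨d, rfl⟩ := Nat.exists_eq_add_of_lt (Finset.mem_range.1 hs)
    have : i + 2 ^ (s + d + 1) = i + 2 ^ s * (2 * 2 ^ d) := by ring
    rw [bit, bit, this, Nat.add_mul_div_left _ _ (by positivity), Nat.add_mul_mod_self_left]
  · rw [bit, Nat.add_div_right _ (by positivity), Nat.div_eq_of_lt hi]

/-- The row `g_i` has minimum weight in its one-coset. -/
theorem two_pow_sum_bit_le_hammingNorm (n i : ℕ) (hi : i < 2 ^ n) (x : Fin (2 ^ n) → ZMod 2)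
    (hx : x ∈ oneCoset n ⟨i, hi⟩) :
    2 ^ (∑ s ∈ Finset.range n, bit i s) ≤ hammingNorm x := by
  induction n generalizing i with
  | zero =>
    obtain ⟨v, hv, rfl⟩ := hx
    have hv0 : v = 0 := by
      have : {v | ∃ j : Fin (2 ^ 0), i < (j : ℕ) ∧ v = row 0 j} = ∅ := by
        ext v
        simp only [Set.mem_ofPred_eq, Set.mem_empty_iff_false, iff_false]
        rintro ⟨j, hj, -⟩
        have := j.2
        omega
      rw [spanAbove, this, Submodule.span_empty] at hv
      exact hv
    subst hv0
    simp only [Finset.range_zero, Finset.sum_empty, pow_zero, add_zero]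
    refine hammingNorm_pos_iff.2 fun h => ?_
    have := congrFun h ⟨i, hi⟩
    simp [row, G] at this
  | succ n ih =>
    by_cases h : i < 2 ^ n
    · obtain ⟨x, hx', y, rfl⟩ := (mem_oneCoset_succ_low h hi).1 hx
      rw [sum_bit_low h, hammingNorm_app2_add_self]
      exact (ih i h x hx').trans (Nat.le_add_right _ _)
    · obtain ⟨l, rfl⟩ := Nat.exists_eq_add_of_le' (not_lt.1 h)
      have hl : l < 2 ^ n := by rw [pow_succ] at hi; omega
      rw [oneCoset_succ_high hl hi] at hx
      obtain ⟨x, hx, rfl⟩ := hx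
      rw [sum_bit_high hl, pow_succ', hammingNorm_app2Diag]
      exact Nat.mul_le_mul_left 2 (ih l hl x hx)

/-- The vectors whose support is contained in that of `x`. -/
def coveredBy {m : ℕ} (x : Fin m → ZMod 2) : Finset (Fin m → ZMod 2) :=
  Fintype.piFinset fun k => if x k = 0 then {0} else Finset.univ

theorem mem_coveredBy {m : ℕ} {x y : Fin m → ZMod 2} :
    y ∈ coveredBy x ↔ ∀ k, x k = 0 → y k = 0 := by
  simp only [coveredBy, Fintype.mem_piFinset]
  refine forall_congr' fun k => ?_
  split_ifs with h <;> simp [h]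

theorem card_coveredBy {m : ℕ} (x : Fin m → ZMod 2) :
    (coveredBy x).card = 2 ^ hammingNorm x := by
  rw [coveredBy, Fintype.card_piFinset, hammingNorm_eq_sum, ← Finset.prod_pow_eq_pow_sum]
  refine Finset.prod_congr rfl fun k _ => ?_
  by_cases h : x k = 0 <;> simp [h, ZMod.card]

theorem hammingNorm_app2_add_self_eq_iff {n : ℕ} {x y : Fin (2 ^ n) → ZMod 2} :
    hammingNorm (app2 (x + y) y) = hammingNorm x ↔ y ∈ coveredBy x := by
  rw [hammingNorm_app2_add_self, mem_coveredBy]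
  simp [Finset.filter_eq_empty_iff]

theorem S_succ_low {n i w : ℕ} (hi : i < 2 ^ n) (hi' : i < 2 ^ (n + 1))
    (hw : ∀ x ∈ oneCoset n ⟨i, hi⟩, w ≤ hammingNorm x) :
    S (n + 1) ⟨i, hi'⟩ w = 2 ^ w * S n ⟨i, hi⟩ w := by
  classical
  set T : Finset (Fin (2 ^ n) → ZMod 2) :=
    Finset.univ.filter fun x => x ∈ oneCoset n ⟨i, hi⟩ ∧ hammingNorm x = w with hT
  have hS : S n ⟨i, hi⟩ w = T.card := by
    rw [S, ← Set.ncard_coe_finset]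
    congr 1
    ext x
    simp [hT]
  have hS' : S (n + 1) ⟨i, hi'⟩ w =
      ((T.sigma fun x => coveredBy x).image fun p => app2 (p.1 + p.2) p.2).card := by
    rw [S, ← Set.ncard_coe_finset]
    congr 1
    ext z
    simp only [Set.mem_ofPred_eq, mem_oneCoset_succ_low hi hi', Finset.coe_image, Set.mem_image,
      Finset.mem_coe, Finset.mem_sigma, hT, Finset.mem_filter, Finset.mem_univ, true_and]
    constructor
    · rintro ⟨⟨x, hx, y, rfl⟩, h⟩
      have hxw : hammingNorm x = w := by
        refine le_antisymm ?_ (hw x hx)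
        rw [← h, hammingNorm_app2_add_self]
        exact Nat.le_add_right _ _
      exact ⟨⟨x, y⟩, ⟨⟨hx, hxw⟩, hammingNorm_app2_add_self_eq_iff.1 (h.trans hxw.symm)⟩, rfl⟩
    · rintro ⟨⟨x, y⟩, ⟨⟨hx, hxw⟩, hy⟩, rfl⟩
      exact ⟨⟨x, hx, y, rfl⟩, (hammingNorm_app2_add_self_eq_iff.2 hy).trans hxw⟩
  rw [hS, hS', Finset.card_image_of_injective, Finset.card_sigma, mul_comm, ← smul_eq_mul]
  · refine Finset.sum_const_nat fun x hx => ?_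
    rw [card_coveredBy, (Finset.mem_filter.1 hx).2.2]
  · rintro ⟨x, y⟩ ⟨x', y'⟩ h
    obtain ⟨h₁, rfl⟩ := app2_inj.1 h
    obtain rfl := add_right_cancel h₁
    rfl

theorem S_succ_high {n i : ℕ} (w : ℕ) (hi : i < 2 ^ n) (hi' : i + 2 ^ n < 2 ^ (n + 1)) :
    S (n + 1) ⟨i + 2 ^ n, hi'⟩ (2 * w) = S n ⟨i, hi⟩ w := by
  have hinj : Function.Injective (app2Diag n) := fun _ _ h => (app2_inj.1 h).1
  rw [S, S, ← Set.ncard_image_of_injective _ hinj, oneCoset_succ_high hi hi']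
  congr 1
  ext z
  constructor
  · rintro ⟨⟨x, hx, rfl⟩, h⟩
    rw [hammingNorm_app2Diag] at h
    exact ⟨x, ⟨hx, by omega⟩, rfl⟩
  · rintro ⟨x, ⟨hx, h⟩, rfl⟩
    exact ⟨⟨x, hx, rfl⟩, by rw [hammingNorm_app2Diag, h]⟩

/-- For `N = 2^n`, `0 ≤ i < N`, and `w_i := 2^{p_{n-1}(i)} = w(g_i)`, the
minimum-weight counts at level `n+1` satisfy `S^{(n+1)}_{i,w_i} = 2^{w_i} · S^{(n)}_{i,w_i}`
and `S^{(n+1)}_{i+N,2w_i} = S^{(n)}_{i,w_i}`. -/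
theorem stmt_9 (n : ℕ) (i : ℕ) (hi : i < 2 ^ n) :
    S (n + 1) ⟨i, by rw [pow_succ]; omega⟩ (2 ^ (∑ s ∈ Finset.range n, bit i s)) =
      2 ^ (2 ^ (∑ s ∈ Finset.range n, bit i s)) *
        S n ⟨i, hi⟩ (2 ^ (∑ s ∈ Finset.range n, bit i s)) ∧
    S (n + 1) ⟨i + 2 ^ n, by rw [pow_succ]; omega⟩
        (2 * 2 ^ (∑ s ∈ Finset.range n, bit i s)) =
      S n ⟨i, hi⟩ (2 ^ (∑ s ∈ Finset.range n, bit i s)) := by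
  exact ⟨S_succ_low hi _ (two_pow_sum_bit_le_hammingNorm n i hi), S_succ_high _ hi _⟩
end

section
/- Let N = 2^n, 0 ≤ ℓ < n, and 0 ≤ k < N, and let I_ℓ := {m ∈ [0, N) : b_ℓ(m) = 1} with complement I_ℓ^c. Let q_0, …, q_{N/2 - 1} denote the rows of G_{N/2}. Then the projection of the row g_k of G_N onto the coordinates in I_ℓ^c (taken in increasing order) equals q_{f_ℓ(k)}; and the projection of g_k onto the coordinates in I_ℓ equals the all-zero vector of length N/2 if b_ℓ(k) = 0, and equals q_{f_ℓ(k)} if b_ℓ(k) = 1. -/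
/-- `delBit n l k = Σ_{r=0}^{l-1} b_r(k) 2^r + Σ_{r=l+1}^{n-1} b_r(k) 2^{r-1}` is the
integer obtained from `k < 2^n` by deleting the `l`-th bit of its binary representation. -/
def delBit (n l k : ℕ) : ℕ :=
  ∑ r ∈ Finset.range l, bit k r * 2 ^ r + ∑ r ∈ Finset.Ico (l + 1) n, bit k r * 2 ^ (r - 1)

/-- Closed form of `delBit`: `k` with the `l`-th bit of its binary representation deleted. -/
def eraseBit (l k : ℕ) : ℕ := 2 ^ l * (k / 2 ^ (l + 1)) + k % 2 ^ l

theorem bit_eq_toNat_testBit (i j : ℕ) : bit i j = (i.testBit j).toNat := by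
  rw [bit, Nat.toNat_testBit]

theorem sum_range_bit_mul_two_pow (k l : ℕ) :
    ∑ r ∈ Finset.range l, bit k r * 2 ^ r = k % 2 ^ l := by
  induction l with
  | zero => simp [Nat.mod_one]
  | succ l ih => rw [Finset.sum_range_succ, ih, bit, Nat.mod_pow_succ, mul_comm (2 ^ l)]

theorem delBit_eq_eraseBit {n l k : ℕ} (hl : l < n + 1) (hk : k < 2 ^ (n + 1)) :
    delBit (n + 1) l k = eraseBit l k := by
  have h_high : k / 2 ^ (l + 1) < 2 ^ (n + 1 - (l + 1)) := by
    rw [Nat.div_lt_iff_lt_mul (by positivity), ← pow_add]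
    rwa [Nat.sub_add_cancel (by lia)]
  rw [delBit, eraseBit, sum_range_bit_mul_two_pow, Finset.sum_Ico_eq_sum_range, add_comm]
  congr 1
  rw [← Nat.mod_eq_of_lt h_high, ← sum_range_bit_mul_two_pow, Finset.mul_sum]
  refine Finset.sum_congr rfl fun r _ => ?_
  rw [show l + 1 + r - 1 = l + r by lia, bit, bit, Nat.div_div_eq_div_mul, ← pow_add, pow_add 2 l r]
  ring

theorem testBit_eraseBit (l k r : ℕ) :
    (eraseBit l k).testBit r = if r < l then k.testBit r else k.testBit (r + 1) := by
  rw [eraseBit, Nat.testBit_two_pow_mul_add _ (Nat.mod_lt _ (by positivity))]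
  split_ifs with h
  · simp [Nat.testBit_mod_two_pow, h]
  · rw [Nat.testBit_div_two_pow]
    congr 1
    lia

theorem eraseBit_lt {n l k : ℕ} (hl : l < n + 1) (hk : k < 2 ^ (n + 1)) :
    eraseBit l k < 2 ^ n := by
  refine Nat.lt_pow_two_of_testBit _ fun r hr => ?_
  rw [testBit_eraseBit, if_neg (by lia)]
  exact Nat.testBit_lt_two_pow (hk.trans_le (Nat.pow_le_pow_right (by lia) (by lia)))

theorem eraseBit_lt_eraseBit {l i j : ℕ} (h : i < j) (hb : bit i l = bit j l) :
    eraseBit l i < eraseBit l j := by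
  have h_split (k : ℕ) : 2 ^ l * (2 * (k / 2 ^ (l + 1)) + bit k l) + k % 2 ^ l = k := by
    rw [bit, pow_succ, ← Nat.div_div_eq_div_mul, Nat.div_add_mod, Nat.div_add_mod]
  have hi := h_split i
  have hj := h_split j
  have hi' : i % 2 ^ l < 2 ^ l := Nat.mod_lt _ (by positivity)
  unfold eraseBit
  rw [hb] at hi
  rcases lt_trichotomy (i / 2 ^ (l + 1)) (j / 2 ^ (l + 1)) with hlt | heq | hgt
  · have h_block := Nat.mul_le_mul_left (2 ^ l) (Nat.succ_le_of_lt hlt)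
    rw [Nat.mul_succ] at h_block
    linarith [Nat.zero_le (j % 2 ^ l)]
  · rw [heq] at hi ⊢
    lia
  · exact absurd (Nat.div_le_div_right h.le) hgt.not_ge

theorem testBit_imp_iff_eraseBit (l k j : ℕ) :
    (∀ r, j.testBit r → k.testBit r) ↔
      (j.testBit l → k.testBit l) ∧
        ∀ r, (eraseBit l j).testBit r → (eraseBit l k).testBit r := by
  simp only [testBit_eraseBit]
  constructor
  · refine fun h => ⟨h l, fun r => ?_⟩
    split_ifs
    exacts [h r, h (r + 1)]
  · rintro ⟨hl, h⟩ r
    rcases lt_trichotomy r l with hr | rfl | hr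
    · simpa [hr] using h r
    · exact hl
    · have := h (r - 1)
      rwa [if_neg (by lia), if_neg (by lia), Nat.sub_add_cancel (by lia)] at this

theorem G2_apply (i j : Fin 2) : G2 i j = if (j : ℕ) ≤ i then 1 else 0 := by
  fin_cases i <;> fin_cases j <;> simp [G2]

theorem G_succ_apply (n : ℕ) (i j : Fin (2 ^ (n + 1))) (a c : Fin 2) (b d : Fin (2 ^ n))
    (hi : (i : ℕ) = b + 2 ^ n * a) (hj : (j : ℕ) = d + 2 ^ n * c) :
    G (n + 1) i j = G2 a c * G n b d := by
  have hi' : i = (finProdFinEquiv.trans (finCongr (by ring))) (a, b) := Fin.ext (by simpa using hi)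
  have hj' : j = (finProdFinEquiv.trans (finCongr (by ring))) (c, d) := Fin.ext (by simpa using hj)
  rw [hi', hj', G, Matrix.reindex_apply, Matrix.submatrix_apply, Equiv.symm_apply_apply,
    Equiv.symm_apply_apply, Matrix.kroneckerMap_apply]

open scoped Classical in
/-- An entry of `G n` is `1` exactly when the binary support of the column index is contained
in that of the row index. -/
theorem G_apply (n : ℕ) (i j : Fin (2 ^ n)) :
    G n i j = if ∀ r, (j : ℕ).testBit r → (i : ℕ).testBit r then 1 else 0 := by
  induction n with
  | zero =>
    have hij : i = j := Fin.ext (by have := i.2; have := j.2; lia)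
    subst hij
    simp only [imp_self, implies_true, if_true]
    exact Matrix.one_apply_eq i
  | succ n ih =>
    have h_div (k : Fin (2 ^ (n + 1))) : (k : ℕ) / 2 ^ n < 2 := by
      rw [Nat.div_lt_iff_lt_mul (by positivity), ← pow_succ']
      exact k.2
    have h_mod (k : ℕ) : k % 2 ^ n < 2 ^ n := Nat.mod_lt _ (by positivity)
    have h_erase (k : Fin (2 ^ (n + 1))) : eraseBit n k = k % 2 ^ n := by
      rw [eraseBit, Nat.div_eq_of_lt k.2, mul_zero, zero_add]
    have h_top : (j : ℕ) / 2 ^ n ≤ i / 2 ^ n ↔ ((j : ℕ).testBit n → (i : ℕ).testBit n) := by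
      have := h_div i
      have := h_div j
      rw [Nat.testBit_eq_decide_div_mod_eq, Nat.testBit_eq_decide_div_mod_eq,
        Nat.mod_eq_of_lt (h_div i), Nat.mod_eq_of_lt (h_div j), decide_eq_true_iff,
        decide_eq_true_iff]
      lia
    rw [G_succ_apply n i j ⟨i / 2 ^ n, h_div i⟩ ⟨j / 2 ^ n, h_div j⟩ ⟨i % 2 ^ n, h_mod i⟩
      ⟨j % 2 ^ n, h_mod j⟩ (Nat.mod_add_div _ _).symm (Nat.mod_add_div _ _).symm, ih, G2_apply]
    simp only [h_top, testBit_imp_iff_eraseBit n i j, h_erase, ite_and, ite_mul, one_mul, zero_mul]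

/-- Deleting bit `l` inverts the increasing enumeration of the indices whose bit `l` is `c`. -/
theorem eraseBit_enumeration {n l c : ℕ} (hl : l < n + 1) {e : Fin (2 ^ n) → Fin (2 ^ (n + 1))}
    (he : StrictMono e) (hc : ∀ m, bit (e m) l = c) (m : Fin (2 ^ n)) :
    eraseBit l (e m) = m := by
  let f : Fin (2 ^ n) → Fin (2 ^ n) := fun m => ⟨eraseBit l (e m), eraseBit_lt hl (e m).2⟩
  have hf : StrictMono f := fun a b hab =>
    eraseBit_lt_eraseBit (he hab) ((hc a).trans (hc b).symm)
  have h_id : f = id := (StrictMono.range_inj hf strictMono_id).1 <| by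
    rw [(Finite.surjective_of_injective hf.injective).range_eq, Set.range_id]
  exact congrArg Fin.val (congrFun h_id m)

open scoped Classical in
theorem row_enumeration {n l k c : ℕ} (hl : l < n + 1) (hk : k < 2 ^ (n + 1)) {q : Fin (2 ^ n)}
    (hq : (q : ℕ) = delBit (n + 1) l k) {e : Fin (2 ^ n) → Fin (2 ^ (n + 1))}
    (he : StrictMono e) (hc : ∀ m, bit (e m) l = c) (m : Fin (2 ^ n)) :
    row (n + 1) ⟨k, hk⟩ (e m) = if c ≤ bit k l then row n q m else 0 := by
  have h_bit : c ≤ bit k l ↔ ((e m : ℕ).testBit l → k.testBit l) := by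
    rw [← hc m, bit_eq_toNat_testBit, bit_eq_toNat_testBit]
    cases (e m : ℕ).testBit l <;> cases k.testBit l <;> simp
  simp only [row, G_apply, h_bit, testBit_imp_iff_eraseBit l k, eraseBit_enumeration hl he hc, hq,
    delBit_eq_eraseBit hl hk, ite_and]


/-- Let `N = 2^n` (written with `n+1` so that `N/2 = 2^n`), `0 ≤ l < n+1`,
`0 ≤ k < N`, and `I_l = {m < N : b_l(m) = 1}`. The projection of the row `g_k` of `G_N`
onto the coordinates in `I_l^c` in increasing order (i.e., its composition with the unique
strictly monotone enumeration of `I_l^c`) equals the row `q_{f_l(k)}` of `G_{N/2}`; the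
projection onto `I_l` equals the zero vector if `b_l(k) = 0` and `q_{f_l(k)}` if
`b_l(k) = 1`. -/
theorem stmt_17 (n l k : ℕ) (hl : l < n + 1) (hk : k < 2 ^ (n + 1)) :
    ∀ q : Fin (2 ^ n), (q : ℕ) = delBit (n + 1) l k →
      (∀ e : Fin (2 ^ n) → Fin (2 ^ (n + 1)), StrictMono e →
        Set.range e = {m : Fin (2 ^ (n + 1)) | bit (m : ℕ) l = 0} →
        ∀ m : Fin (2 ^ n), row (n + 1) ⟨k, hk⟩ (e m) = row n q m) ∧
      (∀ e : Fin (2 ^ n) → Fin (2 ^ (n + 1)), StrictMono e →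
        Set.range e = {m : Fin (2 ^ (n + 1)) | bit (m : ℕ) l = 1} →
        ∀ m : Fin (2 ^ n),
          (bit k l = 0 → row (n + 1) ⟨k, hk⟩ (e m) = 0) ∧
          (bit k l = 1 → row (n + 1) ⟨k, hk⟩ (e m) = row n q m)) := by
  intro q hq
  refine ⟨fun e he h_range m => ?_, fun e he h_range m => ?_⟩
  · have hc : ∀ m, bit (e m) l = 0 := fun m => h_range.subset ⟨m, rfl⟩
    rw [row_enumeration hl hk hq he hc, if_pos (Nat.zero_le _)]
  · have hc : ∀ m, bit (e m) l = 1 := fun m => h_range.subset ⟨m, rfl⟩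
    rw [row_enumeration hl hk hq he hc]
    exact ⟨fun h => if_neg (by lia), fun h => if_pos (by lia)⟩
end
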